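/- Let p ∈ (0,2) and s = 1/p − 1/2. There exists C > 0, depending only on p, the number of roots, and an upper bound on the number of children per node, such that for every u ∈ ℓ²(F × S) with ‖u‖_{t,p} < ∞ and every n ∈ ℕ there exists v ∈ ℓ²(F × S) whose support is contained in a set Λ ⊆ F × S with tree structure and #Λ ≤ n, satisfying ‖u − v‖_{ℓ²(F×S)} ≤ C n^{−s} ‖u‖_{t,p}. -/

import Mathlib

open scoped ENNReal

/-- A subset `T` of a forest (with parent map `parent`, roots = nodes with no parent)
is a tree if it contains all roots and the parent of each of its non-root elements. -/
def IsTree {S : Type*} (parent : S → Option S) (T : Set S) : Prop :=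
  (∀ δ : S, parent δ = none → δ ∈ T) ∧
    ∀ δ ∈ T, ∀ δ' : S, parent δ = some δ' → δ' ∈ T

/-- `t_λ(v) = (Σ_{λ'⪯λ} |v_{λ'}|²)^{1/2}`, where `λ' ⪯ λ` means that `λ` is reached
from `λ'` by iterating the parent map (or `λ' = λ`). -/
noncomputable def tcal {S : Type*} (parent : S → Option S) (v : S → ℝ) (lam : S) :
    ℝ :=
  Real.sqrt (∑' lam' :
    {x : S // Relation.ReflTransGen (fun a b : S => parent a = some b) x lam},
    v lam'.1 ^ 2)

/-- `w*_k`, the `k`-th largest of the values `|w_λ|` (the decreasing rearrangement):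
the infimum over all sets `F` of `k−1` indices of the supremum of `|w|` outside `F`. -/
noncomputable def decRear {S : Type*} (w : S → ℝ) (k : ℕ) : ℝ≥0∞ :=
  ⨅ (F : Finset S) (_ : F.card + 1 = k), ⨆ x : {x : S // x ∉ F}, ENNReal.ofReal |w x.1|

/-- The weak-`ℓ_p` quasi-norm `‖w‖_{ℓw_p} = sup_{k≥1} k^{1/p}·w*_k`. -/
noncomputable def wlp {S : Type*} (p : ℝ) (w : S → ℝ) : ℝ≥0∞ :=
  ⨆ k : ℕ, ((k : ℝ≥0∞) + 1) ^ (1 / p) * decRear w (k + 1)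

namespace Stmt8
open Relation

abbrev Below {S : Type*} (parent : S → Option S) (x l : S) : Prop :=
  Relation.ReflTransGen (fun a b : S => parent a = some b) x l

lemma tcal_sq {S : Type*} (parent : S → Option S) (f : S → ℝ)
    (hf : Summable fun x => f x ^ 2) (l : S) :
    ENNReal.ofReal |tcal parent f l| ^ 2 =
      ∑' x : {x : S // Below parent x l}, ENNReal.ofReal (f x.1 ^ 2) := by
  have hs : Summable fun x : {x : S // Below parent x l} => f x.1 ^ 2 :=
    hf.comp_injective Subtype.val_injective
  rw [← ENNReal.ofReal_tsum_of_nonneg (fun x => sq_nonneg _) hs,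
    ← ENNReal.ofReal_pow (abs_nonneg _), sq_abs]
  unfold tcal
  rw [Real.sq_sqrt (tsum_nonneg fun x => sq_nonneg _)]

lemma card_le {S : Type*} (p : ℝ) (hp0 : 0 < p) (w : S → ℝ) (η : ℝ≥0∞)
    (G : Finset S) (hG : ∀ x ∈ G, η ≤ ENNReal.ofReal |w x|) :
    (G.card : ℝ≥0∞) * η ^ p ≤ wlp p w ^ p := by
  rcases Nat.eq_zero_or_pos G.card with h0 | hpos
  · simp [h0]
  obtain ⟨k, hk⟩ : ∃ k, G.card = k + 1 := ⟨G.card - 1, by omega⟩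
  have h1 : η ≤ decRear w (k + 1) := by
    unfold decRear
    refine le_iInf fun F => le_iInf fun hF => ?_
    obtain ⟨x, hx, hxF⟩ := Finset.exists_mem_notMem_of_card_lt_card (s := F) (t := G) (by omega)
    exact (hG x hx).trans (le_iSup (fun x : {x : S // x ∉ F} => ENNReal.ofReal |w x.1|) ⟨x, hxF⟩)
  have h2 : ((k : ℝ≥0∞) + 1) ^ (1 / p) * η ≤ wlp p w :=
    (mul_le_mul_right h1 _).trans
      (le_iSup (fun k : ℕ => ((k : ℝ≥0∞) + 1) ^ (1 / p) * decRear w (k + 1)) k)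
  have h3 := ENNReal.rpow_le_rpow h2 hp0.le
  rw [ENNReal.mul_rpow_of_nonneg _ _ hp0.le, ← ENNReal.rpow_mul, one_div,
    inv_mul_cancel₀ hp0.ne', ENNReal.rpow_one] at h3
  rw [hk]; push_cast; exact h3

lemma slice {S : Type*} (p : ℝ) (hp0 : 0 < p) (hp2 : p < 2) (nR K : ℕ)
    (parent : S → Option S)
    (hwf : WellFounded fun b a : S => parent a = some b)
    (hrfin : {δ : S | parent δ = none}.Finite)
    (hcard : hrfin.toFinset.card = nR)
    (hfin : ∀ δ : S, {δ' : S | parent δ' = some δ}.Finite)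
    (hK : ∀ δ : S, {δ' : S | parent δ' = some δ}.ncard ≤ K)
    (f : S → ℝ) (hf : Summable fun x => f x ^ 2)
    (ha : wlp p (tcal parent f) ≠ ⊤) (η : ℝ≥0∞) (hη : η ≠ 0) (hηt : η ≠ ⊤) :
    ∃ T : Finset S, ((T : Set S) = ∅ ∨ IsTree parent (T : Set S)) ∧
      (T.card : ℝ≥0∞) * η ^ p ≤ ((nR : ℝ≥0∞) + 1) * wlp p (tcal parent f) ^ p ∧
      ∑' x : {x : S // x ∉ T}, ENNReal.ofReal (f x.1 ^ 2) ≤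
        ((K : ℝ≥0∞) + nR) * (wlp p (tcal parent f) ^ p * η ^ (2 - p)) := by
  classical
  set a := wlp p (tcal parent f) with ha_def
  set E : S → ℝ≥0∞ := fun l => ENNReal.ofReal |tcal parent f l| with hE
  have hEsq : ∀ l, E l ^ 2 = ∑' x : {x : S // Below parent x l}, ENNReal.ofReal (f x.1 ^ 2) :=
    tcal_sq parent f hf
  have hηp0 : η ^ p ≠ 0 := by simp [ENNReal.rpow_eq_zero_iff, hη, hηt]
  have hηpt : η ^ p ≠ ⊤ := ENNReal.rpow_ne_top_of_nonneg hp0.le hηt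
  have hapt : a ^ p ≠ ⊤ := ENNReal.rpow_ne_top_of_nonneg hp0.le ha
  have hη2 : η ^ 2 = η ^ p * η ^ (2 - p) := by
    rw [← ENNReal.rpow_add _ _ hη hηt, ← ENNReal.rpow_natCast]; norm_num
  have hT0 : {l | η < E l}.Finite := by
    by_contra hinf
    have hinf : {l | η < E l}.Infinite := hinf
    obtain ⟨m, hm⟩ := ENNReal.exists_nat_gt (ENNReal.div_ne_top hapt hηp0)
    obtain ⟨G, hG, hGc⟩ := hinf.exists_subset_card_eq m
    have := card_le p hp0 (tcal parent f) η G (fun x hx => (hG hx).le)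
    rw [hGc, ← ENNReal.le_div_iff_mul_le (Or.inl hηp0) (Or.inl hηpt)] at this
    exact absurd hm (not_lt.2 this)
  set T0 := hT0.toFinset with hT0_def
  have memT0 : ∀ l, l ∈ T0 ↔ η < E l := by simp [hT0_def]
  have hT0c : (T0.card : ℝ≥0∞) * η ^ p ≤ a ^ p :=
    card_le p hp0 (tcal parent f) η T0 (fun x hx => ((memT0 x).1 hx).le)
  have hEa : ∀ l, E l ^ p ≤ a ^ p := fun l => by
    simpa using card_le p hp0 (tcal parent f) (E l) {l} (by simp [hE])
  have hmono : ∀ l d, parent l = some d → E l ≤ E d := by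
    intro l d h
    have : E l ^ 2 ≤ E d ^ 2 := by
      rw [hEsq, hEsq]
      exact ENNReal.tsum_mono_subtype (fun x => ENNReal.ofReal (f x ^ 2))
        (s := {x | Below parent x l}) (t := {x | Below parent x d})
        (fun x hx => Relation.ReflTransGen.tail hx h)
    exact le_of_not_gt fun hlt => absurd (ENNReal.pow_lt_pow_left two_ne_zero hlt) (not_lt.2 this)
  set R := hrfin.toFinset with hR
  have memR : ∀ l, l ∈ R ↔ parent l = none := by simp [hR]
  set M := (R ∪ T0.biUnion fun δ => (hfin δ).toFinset) \ T0 with hM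
  have hcover : ∀ l, l ∉ T0 → ∃ m ∈ M, Below parent l m := by
    intro l
    induction l using hwf.induction with
    | _ l ih =>
      intro hl
      rcases hpl : parent l with _ | d
      · exact ⟨l, by simp [hM, hl, memR, hpl], Relation.ReflTransGen.refl⟩
      · by_cases hd : d ∈ T0
        · refine ⟨l, ?_, Relation.ReflTransGen.refl⟩
          simp only [hM, Finset.mem_sdiff, Finset.mem_union, Finset.mem_biUnion]
          exact ⟨Or.inr ⟨d, hd, by simpa using hpl⟩, hl⟩
        · obtain ⟨m, hm, hb⟩ := ih d hpl hd
          exact ⟨m, hm, Relation.ReflTransGen.head hpl hb⟩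
  have hMc : M.card ≤ nR + T0.card * K := by
    refine (Finset.card_le_card Finset.sdiff_subset).trans ((Finset.card_union_le _ _).trans ?_)
    rw [hcard]
    gcongr
    refine Finset.card_biUnion_le_card_mul _ _ _ fun d _ => ?_
    rw [← Set.ncard_eq_toFinset_card _ (hfin d)]; exact hK d
  have hsum : ∀ T : Finset S, T0 ⊆ T →
      ∑' x : {x : S // x ∉ T}, ENNReal.ofReal (f x.1 ^ 2) ≤ ∑ m ∈ M, E m ^ 2 := by
    intro T hT
    have h1 : ∑' x : {x : S // x ∉ T}, ENNReal.ofReal (f x.1 ^ 2) ≤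
        ∑' x : (⋃ m ∈ M, {x | Below parent x m} : Set S), ENNReal.ofReal (f x.1 ^ 2) :=
      ENNReal.tsum_mono_subtype (fun x => ENNReal.ofReal (f x ^ 2))
        (s := {x | x ∉ T}) (t := ⋃ m ∈ M, {x | Below parent x m}) (by
          intro x hx
          obtain ⟨m, hm, hb⟩ := hcover x (fun h => hx (hT h))
          simp only [Set.mem_iUnion]
          exact ⟨m, hm, hb⟩)
    refine h1.trans ((ENNReal.tsum_biUnion_le (fun x => ENNReal.ofReal (f x ^ 2)) M _).trans ?_)
    exact Finset.sum_le_sum fun m _ => (hEsq m).ge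
  have hMη : ∀ m ∈ M, E m ≤ η := by
    intro m hm
    have := (Finset.mem_sdiff.1 hm).2
    rw [memT0] at this
    exact not_lt.1 this
  rcases Finset.eq_empty_or_nonempty T0 with h0 | hne
  · refine ⟨∅, Or.inl (by simp), by simp, (hsum ∅ (by simp [h0])).trans ?_⟩
    have : ∀ m ∈ M, E m ^ 2 ≤ a ^ p * η ^ (2 - p) := by
      intro m hm
      have : E m ^ 2 = E m ^ p * E m ^ (2 - p) := by
        rw [← ENNReal.rpow_add_of_nonneg _ _ hp0.le (by linarith), ← ENNReal.rpow_natCast]; norm_num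
      rw [this]
      exact mul_le_mul' (hEa m) (ENNReal.rpow_le_rpow (hMη m hm) (by linarith))
    refine (Finset.sum_le_card_nsmul _ _ _ this).trans ?_
    rw [nsmul_eq_mul]
    gcongr
    have : M.card ≤ K + nR := by rw [h0] at hMc; simp at hMc; omega
    exact_mod_cast this
  · have hpos : 1 ≤ T0.card := hne.card_pos
    refine ⟨T0 ∪ R, Or.inr ⟨?_, ?_⟩, ?_, (hsum _ Finset.subset_union_left).trans ?_⟩
    · intro d hd
      simp [memR, hd]
    · intro l hl d hd
      simp only [Finset.coe_union, Set.mem_union, Finset.mem_coe] at hl ⊢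
      rcases hl with hl | hl
      · left; rw [memT0] at hl ⊢; exact hl.trans_le (hmono _ _ hd)
      · rw [memR, hd] at hl; cases hl
    · have hc : (T0 ∪ R).card ≤ (nR + 1) * T0.card := by
        refine (Finset.card_union_le _ _).trans ?_
        rw [hcard]; nlinarith
      calc ((T0 ∪ R).card : ℝ≥0∞) * η ^ p ≤ (((nR + 1) * T0.card : ℕ) : ℝ≥0∞) * η ^ p := by
            gcongr
        _ = ((nR : ℝ≥0∞) + 1) * (T0.card * η ^ p) := by push_cast; ring
        _ ≤ _ := by gcongr
    · refine (Finset.sum_le_card_nsmul _ _ (η ^ 2) fun m hm => ?_).trans ?_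
      · exact pow_le_pow_left' (hMη m hm) 2
      rw [nsmul_eq_mul]
      have hc : M.card ≤ (K + nR) * T0.card := by nlinarith
      calc (M.card : ℝ≥0∞) * η ^ 2 ≤ (((K + nR) * T0.card : ℕ) : ℝ≥0∞) * η ^ 2 := by gcongr
        _ = ((K : ℝ≥0∞) + nR) * ((T0.card * η ^ p) * η ^ (2 - p)) := by
            rw [hη2]; push_cast; ring
        _ ≤ _ := by gcongr

end Stmt8

namespace Stmt8

open Classical in
lemma glob {S F : Type*} (p : ℝ) (hp0 : 0 < p) (hp2 : p < 2) (nR K : ℕ)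
    (parent : S → Option S)
    (hwf : WellFounded fun b a : S => parent a = some b)
    (hrfin : {δ : S | parent δ = none}.Finite)
    (hcard : hrfin.toFinset.card = nR)
    (hfin : ∀ δ : S, {δ' : S | parent δ' = some δ}.Finite)
    (hK : ∀ δ : S, {δ' : S | parent δ' = some δ}.ncard ≤ K)
    (u : F × S → ℝ) (hu : Summable fun q => u q ^ 2)
    (hA : ∑' ν : F, wlp p (tcal parent fun lam => u (ν, lam)) ^ p ≠ ⊤)
    (η : ℝ≥0∞) (hη : η ≠ 0) (hηt : η ≠ ⊤) :
    ∃ Λ : Finset (F × S),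
      (∀ ν : F, {lam : S | (ν, lam) ∈ Λ} = (∅ : Set S) ∨
                  IsTree parent {lam : S | (ν, lam) ∈ Λ}) ∧
      (Λ.card : ℝ≥0∞) * η ^ p ≤
        ((nR : ℝ≥0∞) + 1) * ∑' ν : F, wlp p (tcal parent fun lam => u (ν, lam)) ^ p ∧
      ∑' q : F × S, (if q ∈ Λ then 0 else ENNReal.ofReal (u q ^ 2)) ≤
        ((K : ℝ≥0∞) + nR) *
          ((∑' ν : F, wlp p (tcal parent fun lam => u (ν, lam)) ^ p) * η ^ (2 - p)) := by
  classical
  have hηp0 : η ^ p ≠ 0 := by simp [ENNReal.rpow_eq_zero_iff, hη, hηt]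
  have hηpt : η ^ p ≠ ⊤ := ENNReal.rpow_ne_top_of_nonneg hp0.le hηt
  have key := fun ν : F => slice p hp0 hp2 nR K parent hwf hrfin hcard hfin hK
    (fun l => u (ν, l)) (hu.comp_injective (Prod.mk_right_injective ν))
    (fun h => by
      have := ENNReal.ne_top_of_tsum_ne_top hA ν
      rw [h, ENNReal.top_rpow_of_pos hp0] at this
      exact this rfl) η hη hηt
  choose T hT hTc hTs using key
  have hsum : (∑' ν, ((T ν).card : ℝ≥0∞)) * η ^ p ≤
      ((nR : ℝ≥0∞) + 1) * ∑' ν : F, wlp p (tcal parent fun lam => u (ν, lam)) ^ p := by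
    rw [← ENNReal.tsum_mul_right, ← ENNReal.tsum_mul_left]
    exact ENNReal.tsum_le_tsum hTc
  have hne : ∑' ν, ((T ν).card : ℝ≥0∞) ≠ ⊤ := by
    intro h
    rw [h, ENNReal.top_mul hηp0, top_le_iff] at hsum
    exact ENNReal.mul_ne_top (by finiteness) hA hsum
  have hfinT := ENNReal.finite_const_le_of_tsum_ne_top hne (ε := 1) one_ne_zero
  set I := hfinT.toFinset with hI
  have memI : ∀ ν, ν ∈ I ↔ 1 ≤ (T ν).card := by
    intro ν; simp only [hI, Set.Finite.mem_toFinset, Set.mem_ofPred_eq]; norm_cast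
  set Λ : Finset (F × S) := I.biUnion fun ν => (T ν).map ⟨Prod.mk ν, Prod.mk_right_injective ν⟩
    with hΛ
  have memΛ : ∀ ν l, (ν, l) ∈ Λ ↔ l ∈ T ν := by
    intro ν l
    simp only [hΛ, Finset.mem_biUnion, Finset.mem_map, Function.Embedding.coeFn_mk, Prod.mk.injEq]
    constructor
    · rintro ⟨ν', _, l', hl, rfl, rfl⟩; exact hl
    · intro h
      exact ⟨ν, (memI ν).2 (Finset.card_pos.2 ⟨l, h⟩), l, h, rfl, rfl⟩
  refine ⟨Λ, ?_, ?_, ?_⟩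
  · intro ν
    have : {lam : S | (ν, lam) ∈ Λ} = (T ν : Set S) := by ext l; simp [memΛ]
    rw [this]; exact hT ν
  · refine le_trans ?_ hsum
    gcongr
    calc (Λ.card : ℝ≥0∞) ≤ ((∑ ν ∈ I, (T ν).card : ℕ) : ℝ≥0∞) := by
          refine Nat.cast_le.2 (Finset.card_biUnion_le.trans ?_)
          simp
      _ = ∑ ν ∈ I, ((T ν).card : ℝ≥0∞) := by push_cast; rfl
      _ ≤ _ := ENNReal.sum_le_tsum I
  · rw [ENNReal.tsum_prod', ← ENNReal.tsum_mul_right, ← ENNReal.tsum_mul_left]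
    refine ENNReal.tsum_le_tsum fun ν => le_trans (le_of_eq ?_) (hTs ν)
    rw [show (∑' x : {x : S // x ∉ T ν}, ENNReal.ofReal (u (ν, x.1) ^ 2)) =
      ∑' x : ({x : S | x ∉ T ν} : Set S), ENNReal.ofReal (u (ν, x.1) ^ 2) from rfl,
      tsum_subtype {x : S | x ∉ T ν} (fun x => ENNReal.ofReal (u (ν, x) ^ 2))]
    refine tsum_congr fun l => ?_
    by_cases h : l ∈ T ν <;> simp [memΛ, h, Set.indicator]

end Stmt8

/-- Corollary 4.4 of the paper: best `n`-term approximation with spatial tree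
structure.  With `s = 1/p − 1/2`, there is `C > 0` (depending only on `p`, the number
of roots, and a bound on the number of children per node) such that every
`u ∈ ℓ²(F × S)` with `‖u‖_{t,p} = (Σ_ν ‖t(u_ν)‖_{ℓw_p}^p)^{1/p} < ∞` admits, for every
`n ≥ 1`, an approximation `v` supported on a set `Λ ⊆ F × S` with tree structure and
`#Λ ≤ n` satisfying `‖u − v‖ ≤ C·n^{−s}·‖u‖_{t,p}`. -/
theorem stmt_8 (p : ℝ) (hp0 : 0 < p) (hp2 : p < 2) (nR K : ℕ) :
    ∃ C : ℝ, 0 < C ∧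
      ∀ (S F : Type) (_ : Countable S) (_ : Countable F) (parent : S → Option S),
        (WellFounded fun b a : S => parent a = some b) →
        ∀ hrfin : {δ : S | parent δ = none}.Finite,
          hrfin.toFinset.card = nR →
          {δ : S | parent δ = none}.Nonempty →
          (∀ δ : S, {δ' : S | parent δ' = some δ}.Finite) →
          (∀ δ : S, {δ' : S | parent δ' = some δ}.ncard ≤ K) →
          ∀ u : lp (fun _ : F × S => ℝ) 2,
            (∑' ν : F, wlp p (tcal parent fun lam => u (ν, lam)) ^ p) ^ (1 / p) ≠ ⊤ →
            ∀ n : ℕ, 0 < n →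
              ∃ (Λ : Finset (F × S)) (v : lp (fun _ : F × S => ℝ) 2),
                (∀ ν : F, {lam : S | (ν, lam) ∈ Λ} = (∅ : Set S) ∨
                  IsTree parent {lam : S | (ν, lam) ∈ Λ}) ∧
                Λ.card ≤ n ∧
                (∀ q : F × S, q ∉ Λ → v q = 0) ∧
                ‖u - v‖ ≤ C * (n : ℝ) ^ (-(1 / p - 1 / 2)) *
                  ((∑' ν : F, wlp p (tcal parent fun lam => u (ν, lam)) ^ p) ^
                    (1 / p)).toReal := by
  classical
  refine ⟨Real.sqrt (((K : ℝ) + nR + 1) * ((nR : ℝ) + 1) ^ ((2 - p) / p)), by positivity, ?_⟩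
  intro S F _ _ parent hwf hrfin hcard _ hfin hK u hN n hn
  set A := ∑' ν : F, wlp p (tcal parent fun lam => u (ν, lam)) ^ p with hA_def
  have hA : A ≠ ⊤ := by
    intro h
    rw [h, ENNReal.top_rpow_of_pos (by positivity)] at hN
    exact hN rfl
  have hu : Summable fun q => u q ^ 2 := by
    have := (lp.memℓp u).summable (by norm_num)
    simpa using this
  have hnr : (0 : ℝ) < n := by exact_mod_cast hn
  -- reduction to a suitable finite set
  suffices h : ∃ Λ : Finset (F × S),
      (∀ ν : F, {lam : S | (ν, lam) ∈ Λ} = (∅ : Set S) ∨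
                  IsTree parent {lam : S | (ν, lam) ∈ Λ}) ∧
      Λ.card ≤ n ∧
      ∑' q : F × S, (if q ∈ Λ then 0 else ENNReal.ofReal (u q ^ 2)) ≤
        ENNReal.ofReal ((((K : ℝ) + nR + 1) * ((nR : ℝ) + 1) ^ ((2 - p) / p)) *
          (n : ℝ) ^ (-((2 - p) / p)) * ((A ^ (1 / p)).toReal) ^ 2) by
    obtain ⟨Λ, h1, h2, h3⟩ := h
    have hv : Memℓp (E := fun _ : F × S => ℝ) (fun q => if q ∈ Λ then u q else 0) 2 := by
      refine memℓp_gen ?_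
      refine summable_of_ne_finset_zero (s := Λ) fun q hq => ?_
      simp [hq]
    refine ⟨Λ, ⟨_, hv⟩, h1, h2, fun q hq => by simp [hq], ?_⟩
    set v : lp (fun _ : F × S => ℝ) 2 := ⟨_, hv⟩ with hv_def
    have hvq : ∀ q, (u - v) q = if q ∈ Λ then 0 else u q := by
      intro q
      have : (u - v) q = u q - (if q ∈ Λ then u q else 0) := rfl
      rw [this]; split_ifs <;> simp
    have hs : Summable fun q => (u - v) q ^ 2 := by
      have := (lp.memℓp (u - v)).summable (by norm_num)
      simpa using this
    have hnorm : ‖u - v‖ ^ 2 = ∑' q, (u - v) q ^ 2 := by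
      have := lp.norm_rpow_eq_tsum (p := 2) (by norm_num) (u - v)
      simpa using this
    have h4 : ENNReal.ofReal (‖u - v‖ ^ 2) =
        ∑' q : F × S, (if q ∈ Λ then 0 else ENNReal.ofReal (u q ^ 2)) := by
      rw [hnorm, ENNReal.ofReal_tsum_of_nonneg (fun q => sq_nonneg _) hs]
      refine tsum_congr fun q => ?_
      rw [hvq]; split_ifs <;> simp
    rw [← h4, ENNReal.ofReal_le_ofReal_iff (by positivity)] at h3
    refine abs_le_of_sq_le_sq' ?_ (by positivity) |>.2
    refine h3.trans (le_of_eq ?_)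
    rw [mul_pow, mul_pow, Real.sq_sqrt (by positivity), ← Real.rpow_natCast ((n : ℝ) ^ _) 2,
      ← Real.rpow_mul hnr.le]
    congr 3
    push_cast; field_simp
  by_cases hA0 : A = 0
  · obtain ⟨Λ, h1, h2, h3⟩ := Stmt8.glob p hp0 hp2 nR K parent hwf hrfin hcard hfin hK u hu hA
      1 one_ne_zero ENNReal.one_ne_top
    rw [← hA_def, hA0] at h2 h3
    simp only [ENNReal.one_rpow, mul_one, mul_zero, nonpos_iff_eq_zero, Nat.cast_eq_zero] at h2
    refine ⟨Λ, h1, by omega, h3.trans (by simp)⟩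
  set N := (A ^ (1 / p)).toReal with hN_def
  have hNpos : 0 < N := ENNReal.toReal_pos (by simp [ENNReal.rpow_eq_zero_iff, hA0, hA]) hN
  have hAN : A = ENNReal.ofReal (N ^ p) := by
    rw [← ENNReal.ofReal_rpow_of_pos hNpos, hN_def, ENNReal.ofReal_toReal hN, ← ENNReal.rpow_mul,
      one_div, inv_mul_cancel₀ hp0.ne', ENNReal.rpow_one]
  have hc : (0 : ℝ) < ((nR : ℝ) + 1) / n := by positivity
  set e : ℝ := N * (((nR : ℝ) + 1) / n) ^ (1 / p) with he
  have hepos : 0 < e := by positivity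
  have hep : e ^ p = N ^ p * (((nR : ℝ) + 1) / n) := by
    rw [he, Real.mul_rpow hNpos.le (by positivity), ← Real.rpow_mul hc.le, one_div,
      inv_mul_cancel₀ hp0.ne', Real.rpow_one]
  obtain ⟨Λ, h1, h2, h3⟩ := Stmt8.glob p hp0 hp2 nR K parent hwf hrfin hcard hfin hK u hu hA
      (ENNReal.ofReal e) (by simpa using hepos) ENNReal.ofReal_ne_top
  rw [← hA_def, hAN, ENNReal.ofReal_rpow_of_pos hepos] at h2 h3
  refine ⟨Λ, h1, ?_, h3.trans ?_⟩
  · have e1 : ((nR : ℝ≥0∞) + 1) = ENNReal.ofReal ((nR : ℝ) + 1) := by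
      rw [ENNReal.ofReal_add (by positivity) (by positivity)]; simp
    rw [e1, ← ENNReal.ofReal_natCast, ← ENNReal.ofReal_mul (Nat.cast_nonneg _),
      ← ENNReal.ofReal_mul (by positivity), ENNReal.ofReal_le_ofReal_iff (by positivity), hep] at h2
    have hNp : 0 < N ^ p := by positivity
    have h5 : (Λ.card : ℝ) * (N ^ p * (nR + 1)) ≤ n * (N ^ p * (nR + 1)) := by
      have := mul_le_mul_of_nonneg_right h2 hnr.le
      have h6 : (Λ.card : ℝ) * (N ^ p * (((nR : ℝ) + 1) / n)) * n
          = (Λ.card : ℝ) * (N ^ p * (nR + 1)) := by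
        rw [mul_assoc, mul_assoc, div_mul_cancel₀ _ hnr.ne']
      linarith
    exact_mod_cast le_of_mul_le_mul_right h5 (by positivity)
  · have e1 : ((K : ℝ≥0∞) + nR) = ENNReal.ofReal ((K : ℝ) + nR) := by
      rw [ENNReal.ofReal_add (by positivity) (by positivity)]; simp
    rw [e1, ← ENNReal.ofReal_mul (by positivity),
      ← ENNReal.ofReal_mul (by positivity)]
    refine ENNReal.ofReal_le_ofReal ?_
    have h7 : N ^ p * e ^ (2 - p) =
        ((nR : ℝ) + 1) ^ ((2 - p) / p) * (n : ℝ) ^ (-((2 - p) / p)) * N ^ 2 := by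
      rw [he, Real.mul_rpow hNpos.le (by positivity), ← Real.rpow_mul hc.le,
        Real.div_rpow (by positivity) hnr.le, Real.rpow_neg hnr.le, ← mul_assoc,
        ← Real.rpow_add hNpos, ← Real.rpow_natCast N 2,
        show p + (2 - p) = ((2 : ℕ) : ℝ) by push_cast; ring,
        show 1 / p * (2 - p) = (2 - p) / p by ring]
      ring
    rw [h7]
    have h8 : 0 ≤ ((nR : ℝ) + 1) ^ ((2 - p) / p) * (n : ℝ) ^ (-((2 - p) / p)) * N ^ 2 := by
      positivity
    nlinarith
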